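/- Let n ≥ 3, α ∈ (2/n, 1], R > 0, T > 0, and c a constant with c − 1 > (2/α)·1/(n − 2/α). Let Ψ(x,t) = C_α ((T − ct)/(|x|² + R²))^{1/α} with C_α^α = 2 n^{α−1}(n − 2/α), and define for 1 ≤ i ≤ n: A_i = −(n/Ψ)^α ∂_{x_i}Ψ, A_{i+n} = −A_i, and B_i = B_{i+n} = (n/Ψ)^α ∂_{x_i}((n/Ψ)^α ∂_{x_i}Ψ) − (α/(2Ψ))((n/Ψ)^α ∂_{x_i}Ψ)². Then there exists a constant c₃ > 0 depending only on c, n, α such that for every ε > 0, the functions u_i^ε = (1/(2n))(Ψ + ε A_i + ε² B_i), i = 1,…,2n, are positive and satisfy the subsolution inequalities ∂_t u_i^ε + (1/ε) v_i·∇_x u_i^ε − (1/(2nε²)) Σ_{j=1}^{2n} (u_i^ε + u_j^ε)^α (u_j^ε − u_i^ε) ≤ 0 for all i = 1,…,2n, at every point (x,t) with ε (|x|²+R²)^{1/2} < c₃ (T − ct) and 0 ≤ t < T/c. -/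

import Mathlib

/-- Partial derivative in the `i`-th coordinate direction. -/
noncomputable def pd {n : ℕ} (i : Fin n) (f : EuclideanSpace ℝ (Fin n) → ℝ)
    (x : EuclideanSpace ℝ (Fin n)) : ℝ :=
  fderiv ℝ f x (EuclideanSpace.single i (1 : ℝ))

/-- The `2n` velocities: `v_i = e_i` for the first copy of `Fin n` and
`v_{i+n} = −e_i` for the second copy. -/
noncomputable def vel {n : ℕ} : (Fin n ⊕ Fin n) → EuclideanSpace ℝ (Fin n) :=
  Sum.elim (fun i => EuclideanSpace.single i (1 : ℝ))
    (fun i => -EuclideanSpace.single i (1 : ℝ))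

lemma one_add_mul_sub_sq_le_one_add_rpow {α s : ℝ} (hα : 0 ≤ α) (hα1 : α ≤ 1)
    (hs : -(1 / 2) ≤ s) : 1 + α * s - s ^ 2 ≤ (1 + s) ^ α := by
  have h1 : (0 : ℝ) < 1 + s := by linarith
  have hb : (1 + s) ^ (1 - α) ≤ 1 + (1 - α) * s :=
    rpow_one_add_le_one_add_mul_self (by linarith) (by linarith) (by linarith)
  have hp : (1 + s) ^ α * (1 + s) ^ (1 - α) = 1 + s := by
    rw [← Real.rpow_add h1]; simp
  have h0 : 0 < (1 + s) ^ α := Real.rpow_pos_of_pos h1 _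
  have hd : 1 / 2 ≤ 1 + (1 - α) * s := by nlinarith
  have h2 : 1 + s ≤ (1 + s) ^ α * (1 + (1 - α) * s) := by
    calc 1 + s = (1 + s) ^ α * (1 + s) ^ (1 - α) := hp.symm
      _ ≤ _ := by gcongr
  have h3 : (1 + α * s - s ^ 2) * (1 + (1 - α) * s) ≤ 1 + s := by
    have h4 : α * (1 - α) ≤ 1 / 4 := by nlinarith [sq_nonneg (α - 1 / 2)]
    have : 0 ≤ s ^ 2 * ((1 + (1 - α) * s) - α * (1 - α)) :=
      mul_nonneg (sq_nonneg s) (by linarith)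
    nlinarith
  exact le_of_mul_le_mul_right (h3.trans h2) (by linarith)

/-- Second order lower bound for one normalised Carleman interaction. -/
lemma interaction_lower_bound {α ℓ a b : ℝ} (hα : 0 ≤ α) (hα1 : α ≤ 1) (hℓ : ℓ ≤ 1 / 2)
    (ha : |a| ≤ ℓ) (hb : |b| ≤ ℓ) :
    (b - a) + α / 2 * (b ^ 2 - a ^ 2) - 2 * ℓ ^ 3 ≤
      (1 + (a + b) / 2) ^ α * (b - a) := by
  obtain ⟨ha1, ha2⟩ := abs_le.1 ha
  obtain ⟨hb1, hb2⟩ := abs_le.1 hb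
  have hℓ0 : 0 ≤ ℓ := (abs_nonneg a).trans ha
  set s := (a + b) / 2 with hs
  have hlo : 1 + α * s - s ^ 2 ≤ (1 + s) ^ α :=
    one_add_mul_sub_sq_le_one_add_rpow hα hα1 (by linarith)
  have hup : (1 + s) ^ α ≤ 1 + α * s :=
    rpow_one_add_le_one_add_mul_self (by linarith) hα hα1
  have hs2 : s ^ 2 ≤ ℓ ^ 2 := sq_le_sq' (by linarith) (by linarith)
  have key : |((1 + s) ^ α - (1 + α * s)) * (b - a)| ≤ ℓ ^ 2 * (2 * ℓ) := by
    rw [abs_mul]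
    exact mul_le_mul (abs_le.2 ⟨by linarith, by linarith [sq_nonneg ℓ]⟩)
      (abs_le.2 ⟨by linarith, by linarith⟩) (abs_nonneg _) (sq_nonneg _)
  have h1 := (abs_le.1 key).1
  have h2 : α / 2 * (b ^ 2 - a ^ 2) = α * s * (b - a) := by rw [hs]; ring
  rw [h2]
  linarith

/-- Relative size of the first and second order correctors, as a function of the scaled
parameter `η` and of the scaled component `p` of the position along the velocity. -/
noncomputable def corrector (β K η p : ℝ) : ℝ :=
  β * K * η * p + β * K ^ 2 * η ^ 2 * ((β - 1) * p ^ 2 - 1)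

lemma abs_quadratic_le {β p : ℝ} (hβ : 2 ≤ β) (hp : |p| ≤ 1) :
    |(β - 1) * p ^ 2 - 1| ≤ β := by
  have h1 : p ^ 2 ≤ 1 := (sq_le_one_iff_abs_le_one p).2 hp
  have h0 := sq_nonneg p
  rw [abs_le]
  constructor <;> nlinarith

lemma abs_corrector_le {β K η p : ℝ} (hβ : 2 ≤ β) (hK : 0 < K) (hη : 0 < η) (hη1 : η ≤ 1)
    (hp : |p| ≤ 1) : |corrector β K η p| ≤ (β * K + β ^ 2 * K ^ 2) * η := by
  have hb := abs_quadratic_le hβ hp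
  have h0 : 0 < β := by linarith
  unfold corrector
  calc |β * K * η * p + β * K ^ 2 * η ^ 2 * ((β - 1) * p ^ 2 - 1)|
      ≤ |β * K * η * p| + |β * K ^ 2 * η ^ 2 * ((β - 1) * p ^ 2 - 1)| := abs_add_le _ _
    _ = β * K * η * |p| + β * K ^ 2 * η ^ 2 * |(β - 1) * p ^ 2 - 1| := by
        rw [abs_mul, abs_mul (β * K ^ 2 * η ^ 2), abs_of_pos (by positivity : 0 < β * K * η),
          abs_of_pos (by positivity : 0 < β * K ^ 2 * η ^ 2)]
    _ ≤ β * K * η * 1 + β * K ^ 2 * (η * 1) * β := by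
        rw [pow_two η]; gcongr
    _ = _ := by ring

/-- The transport part `∂_t u + ε⁻¹ v·∇u` of the expansion, divided by `Ψ / (2nτ)`. -/
noncomputable def transport (β K c η p : ℝ) : ℝ :=
  -c * (β / 2 + (β / 2 - 1) * (β * K * η * p) +
      (β / 2 - 2) * (β * K ^ 2 * η ^ 2 * ((β - 1) * p ^ 2 - 1))) -
    β * p / η + β * K * (1 - β * p ^ 2) +
    η * β * K ^ 2 * (β * p - β * (β - 1) * p ^ 3 + 2 * (β - 2) * p)

/-- Constant bounding the error terms of relative order `η`. -/
noncomputable def errorConst (β K c : ℝ) : ℝ :=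
  c * β * (β * K) + c * (β + 2) * (β * K ^ 2) * β + β * K ^ 2 * (β + β * β + 2 * β) +
    β * K ^ 2 * (2 * β + K * β ^ 2) + 2 * (β * K + β ^ 2 * K ^ 2) ^ 3 / K

lemma error_terms_le {β K c η p : ℝ} (hβ : 2 ≤ β) (hK : 0 < K) (hc : 0 < c)
    (hη : 0 < η) (hη1 : η ≤ 1) (hp : |p| ≤ 1) :
    -c * ((β / 2 - 1) * (β * K * p)) -
        c * ((β / 2 - 2) * (β * K ^ 2 * η * ((β - 1) * p ^ 2 - 1))) +
      β * K ^ 2 * (β * p - β * (β - 1) * p ^ 3 + 2 * (β - 2) * p) +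
      β * K ^ 2 * (2 * p * ((β - 1) * p ^ 2 - 1) + K * η * ((β - 1) * p ^ 2 - 1) ^ 2) +
      2 * (β * K + β ^ 2 * K ^ 2) ^ 3 / K ≤ errorConst β K c := by
  have hb := abs_quadratic_le hβ hp
  set b := (β - 1) * p ^ 2 - 1 with hbdef
  obtain ⟨p1, p2⟩ := abs_le.1 hp
  have h0 : 0 < β := by linarith
  have t1 : -c * ((β / 2 - 1) * (β * K * p)) ≤ c * β * (β * K) := by
    have : 0 ≤ c * (β * K) * (β + (β / 2 - 1) * p) :=
      mul_nonneg (by positivity) (by nlinarith)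
    linarith
  have hηb : |η * b| ≤ β := by
    rw [abs_mul, abs_of_pos hη]
    nlinarith [abs_nonneg b]
  have t2 : -(c * ((β / 2 - 2) * (β * K ^ 2 * η * b))) ≤ c * (β + 2) * (β * K ^ 2) * β := by
    have h1 : |(β / 2 - 2) * (η * b)| ≤ (β + 2) * β := by
      rw [abs_mul]
      exact mul_le_mul (abs_le.2 ⟨by linarith, by linarith⟩) hηb (abs_nonneg _) (by linarith)
    have : 0 ≤ c * (β * K ^ 2) * ((β + 2) * β + (β / 2 - 2) * (η * b)) :=
      mul_nonneg (by positivity) (by linarith [(abs_le.1 h1).1])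
    linarith
  have t3 : β * K ^ 2 * (β * p - β * (β - 1) * p ^ 3 + 2 * (β - 2) * p) ≤
      β * K ^ 2 * (β + β * β + 2 * β) := by
    have h3 : |p ^ 3| ≤ 1 := by rw [abs_pow]; exact pow_le_one₀ (abs_nonneg _) hp
    have h3' := (abs_le.1 h3).1
    have e1 : β * p ≤ β := by nlinarith
    have e2 : -(β * (β - 1) * p ^ 3) ≤ β * β := by
      have : 0 ≤ β * (β - 1) := mul_nonneg h0.le (by linarith)
      nlinarith
    have e3 : 2 * (β - 2) * p ≤ 2 * β := by nlinarith
    gcongr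
    linarith
  have t4 : β * K ^ 2 * (2 * p * b + K * η * b ^ 2) ≤ β * K ^ 2 * (2 * β + K * β ^ 2) := by
    have e1 : p * b ≤ β := by
      calc p * b ≤ |p * b| := le_abs_self _
        _ = |p| * |b| := abs_mul _ _
        _ ≤ 1 * β := by gcongr
        _ = β := one_mul _
    have e2 : η * b ^ 2 ≤ β ^ 2 := by
      have : b ^ 2 ≤ β ^ 2 := sq_le_sq' (by linarith [(abs_le.1 hb).1]) (abs_le.1 hb).2
      nlinarith [sq_nonneg b]
    have e3 : K * (η * b ^ 2) ≤ K * β ^ 2 := by gcongr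
    exact mul_le_mul_of_nonneg_left (by linarith) (by positivity)
  unfold errorConst
  linarith

open Finset in
lemma transport_sub_collision_nonpos {n : ℕ} (hn : 0 < n) {α β K c η : ℝ} (hβα : α * β = 2)
    (hα : 0 < α) (hα1 : α ≤ 1) (hβ : 2 ≤ β) (hK : 0 < K) (hc : 0 < c) (hη : 0 < η)
    (hη1 : η ≤ 1) (hL : (β * K + β ^ 2 * K ^ 2) * η ≤ 1 / 2)
    (hM : errorConst β K c * η ≤ β * (c / 2 - K))
    (y : Fin n → ℝ) (hy : ∀ i, |y i| ≤ 1) (p : ℝ) (hp : |p| ≤ 1) :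
    transport β K c η p - 1 / (2 * n * K * η ^ 2) *
      ((∑ j, (1 + (corrector β K η p + corrector β K η (y j)) / 2) ^ α *
          (corrector β K η (y j) - corrector β K η p)) +
        ∑ j, (1 + (corrector β K η p + corrector β K η (-y j)) / 2) ^ α *
          (corrector β K η (-y j) - corrector β K η p)) ≤ 0 := by
  have hn' : (0 : ℝ) < n := by exact_mod_cast hn
  have h0 : 0 < β := by linarith
  set L := β * K + β ^ 2 * K ^ 2 with hLdef
  set b := (β - 1) * p ^ 2 - 1 with hbdef
  have hα' : α = 2 / β := by field_simp; linarith
  rw [← sum_add_distrib]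
  have hterm : ∀ j, 2 * (β * K ^ 2 * η ^ 2 * (-(β - 1) * p ^ 2)) - 2 * (β * K * η * p)
      - 2 * β * K ^ 2 * η ^ 2 * p ^ 2 - 2 * β * K ^ 3 * η ^ 3 * (2 * p * b + K * η * b ^ 2)
      - 4 * (L * η) ^ 3 ≤
      (1 + (corrector β K η p + corrector β K η (y j)) / 2) ^ α *
          (corrector β K η (y j) - corrector β K η p) +
      (1 + (corrector β K η p + corrector β K η (-y j)) / 2) ^ α *
          (corrector β K η (-y j) - corrector β K η p) := by
    intro j
    have i1 := interaction_lower_bound hα.le hα1 hL (abs_corrector_le hβ hK hη hη1 hp)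
      (abs_corrector_le hβ hK hη hη1 (hy j))
    have i2 := interaction_lower_bound hα.le hα1 hL (abs_corrector_le hβ hK hη hη1 hp)
      (abs_corrector_le hβ hK hη hη1 (by rw [abs_neg]; exact hy j : |-y j| ≤ 1))
    refine le_trans ?_ (add_le_add i1 i2)
    have hd : (0 : ℝ) ≤ 2 * β * K ^ 2 * η ^ 2 * ((β - 1) * y j ^ 2 + y j ^ 2)
        + 2 * β * K ^ 4 * η ^ 4 * ((β - 1) * y j ^ 2 - 1) ^ 2 := by
      have : (0 : ℝ) ≤ (β - 1) * y j ^ 2 := mul_nonneg (by linarith) (sq_nonneg _)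
      positivity
    rw [← sub_nonneg]
    refine hd.trans_eq ?_
    rw [hα']
    unfold corrector
    field_simp
    ring
  have hsum := sum_le_sum (s := univ) fun j _ => hterm j
  rw [sum_const, card_univ, Fintype.card_fin, nsmul_eq_mul] at hsum
  have hpos : (0 : ℝ) < 1 / (2 * n * K * η ^ 2) := by positivity
  have hmul := mul_le_mul_of_nonneg_left hsum hpos.le
  have herr := mul_le_mul_of_nonneg_left (error_terms_le hβ hK hc hη hη1 hp) hη.le
  refine le_trans (sub_le_sub_left hmul _) ?_
  refine le_trans (le_of_eq ?_) (show
    -(β * (c / 2 - K)) + η * (-c * ((β / 2 - 1) * (β * K * p)) -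
        c * ((β / 2 - 2) * (β * K ^ 2 * η * ((β - 1) * p ^ 2 - 1))) +
      β * K ^ 2 * (β * p - β * (β - 1) * p ^ 3 + 2 * (β - 2) * p) +
      β * K ^ 2 * (2 * p * ((β - 1) * p ^ 2 - 1) + K * η * ((β - 1) * p ^ 2 - 1) ^ 2) +
      2 * (β * K + β ^ 2 * K ^ 2) ^ 3 / K) ≤ 0 by linarith)
  unfold transport
  rw [hbdef, hLdef]
  field_simp
  ring

/-- The barrier `C (τ / (|x|² + R²))^{1/α}`. -/
noncomputable def barrier {n : ℕ} (C τ R α : ℝ) (x : EuclideanSpace ℝ (Fin n)) : ℝ :=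
  C * (τ / (‖x‖ ^ 2 + R ^ 2)) ^ (1 / α)

section Calculus

variable {n : ℕ} {C τ R α : ℝ}

lemma barrier_pos (hC : 0 < C) (hτ : 0 < τ) (hR : 0 < R) (x : EuclideanSpace ℝ (Fin n)) :
    0 < barrier C τ R α x := by
  unfold barrier
  positivity

lemma rpow_barrier (hC : 0 < C) (hτ : 0 < τ) (hR : 0 < R) (hα : 0 < α)
    (x : EuclideanSpace ℝ (Fin n)) :
    barrier C τ R α x ^ α = C ^ α * (τ / (‖x‖ ^ 2 + R ^ 2)) := by
  unfold barrier
  rw [Real.mul_rpow hC.le (by positivity), ← Real.rpow_mul (by positivity),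
    one_div_mul_cancel hα.ne', Real.rpow_one]

lemma hasFDerivAt_norm_sq_add (R : ℝ) (x : EuclideanSpace ℝ (Fin n)) :
    HasFDerivAt (fun z : EuclideanSpace ℝ (Fin n) => ‖z‖ ^ 2 + R ^ 2)
      ((2 : ℝ) • innerSL ℝ x) x := by
  have h := (hasStrictFDerivAt_norm_sq x).hasFDerivAt.add_const (R ^ 2)
  refine h.congr_fderiv ?_
  ext v
  simp

lemma hasFDerivAt_barrier (hτ : 0 < τ) (hR : 0 < R) (x : EuclideanSpace ℝ (Fin n)) :
    HasFDerivAt (barrier C τ R α)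
      ((-(2 / α) * barrier C τ R α x / (‖x‖ ^ 2 + R ^ 2)) • innerSL ℝ x) x := by
  have hq : 0 < ‖x‖ ^ 2 + R ^ 2 := by positivity
  have h1 := ((hasDerivAt_inv hq.ne').const_mul τ).rpow_const (p := 1 / α)
    (Or.inl (by positivity))
  have h2 := (h1.const_mul C).comp_hasFDerivAt x (hasFDerivAt_norm_sq_add R x)
  have h3 := Real.rpow_sub_one (show τ * (‖x‖ ^ 2 + R ^ 2)⁻¹ ≠ 0 by positivity) (1 / α)
  rw [h3, smul_smul] at h2
  refine h2.congr_fderiv ?_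
  unfold barrier
  congr 1
  rw [div_eq_mul_inv τ]
  field_simp

lemma hasDerivAt_barrier {T c t : ℝ} (hτ : 0 < T - c * t) (hR : 0 < R)
    (x : EuclideanSpace ℝ (Fin n)) :
    HasDerivAt (fun s => barrier C (T - c * s) R α x)
      (-c / α * barrier C (T - c * t) R α x / (T - c * t)) t := by
  have hq : 0 < ‖x‖ ^ 2 + R ^ 2 := by positivity
  have h0 : HasDerivAt (fun s => T - c * s) (-c) t := by
    simpa using ((hasDerivAt_id t).const_mul c).const_sub T
  have h1 := ((h0.div_const (‖x‖ ^ 2 + R ^ 2)).rpow_const (p := 1 / α)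
    (Or.inl (by positivity))).const_mul C
  rw [Real.rpow_sub_one (by positivity)] at h1
  refine h1.congr_deriv ?_
  unfold barrier
  field_simp

lemma norm_vel (i : Fin n ⊕ Fin n) : ‖vel i‖ = 1 := by
  rcases i with i | i <;> simp [vel]

lemma inner_vel_inl (i : Fin n) (x : EuclideanSpace ℝ (Fin n)) :
    inner ℝ (vel (Sum.inl i)) x = x i := by
  simp [vel, EuclideanSpace.inner_single_left]

lemma inner_vel_inr (i : Fin n) (x : EuclideanSpace ℝ (Fin n)) :
    inner ℝ (vel (Sum.inr i)) x = -x i := by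
  simp [vel, EuclideanSpace.inner_single_left, inner_neg_left]

lemma pd_barrier (hτ : 0 < τ) (hR : 0 < R) (i : Fin n) (x : EuclideanSpace ℝ (Fin n)) :
    pd i (barrier C τ R α) x =
      -(2 / α) * barrier C τ R α x / (‖x‖ ^ 2 + R ^ 2) * x i := by
  unfold pd
  rw [(hasFDerivAt_barrier hτ hR x).fderiv]
  simp [EuclideanSpace.inner_single_right]

lemma pd_mul_coord_barrier (hτ : 0 < τ) (hR : 0 < R) (k : ℝ) (i : Fin n)
    (x : EuclideanSpace ℝ (Fin n)) :
    pd i (fun z => k * (z i * barrier C τ R α z)) x =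
      k * barrier C τ R α x * (1 - 2 / α * x i ^ 2 / (‖x‖ ^ 2 + R ^ 2)) := by
  have h1 : HasFDerivAt (fun z : EuclideanSpace ℝ (Fin n) => z i)
      (EuclideanSpace.proj i : EuclideanSpace ℝ (Fin n) →L[ℝ] ℝ) x :=
    (EuclideanSpace.proj i : EuclideanSpace ℝ (Fin n) →L[ℝ] ℝ).hasFDerivAt
  have h2 := (h1.fun_mul (hasFDerivAt_barrier (C := C) (α := α) hτ hR x)).const_mul k
  unfold pd
  rw [h2.fderiv]
  simp [EuclideanSpace.inner_single_right]
  ring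

/-- Closed form of the second order expansion along the velocity `v`. -/
noncomputable def expansion (C τ R α K ε : ℝ) (v x : EuclideanSpace ℝ (Fin n)) : ℝ :=
  1 / (2 * n) * (barrier C τ R α x * (1 + ε * (2 / α) * K * inner ℝ v x / τ +
    ε ^ 2 * (2 / α) * K ^ 2 *
      ((2 / α - 1) * inner ℝ v x ^ 2 - (‖x‖ ^ 2 + R ^ 2)) / τ ^ 2))

lemma fderiv_expansion_apply (hτ : 0 < τ) (hR : 0 < R) (K ε : ℝ)
    {v : EuclideanSpace ℝ (Fin n)} (hv : ‖v‖ = 1) (x : EuclideanSpace ℝ (Fin n)) :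
    fderiv ℝ (expansion C τ R α K ε v) x v =
      1 / (2 * n) * barrier C τ R α x *
        (-(2 / α) * inner ℝ v x / (‖x‖ ^ 2 + R ^ 2) *
          (1 + ε * (2 / α) * K * inner ℝ v x / τ + ε ^ 2 * (2 / α) * K ^ 2 *
            ((2 / α - 1) * inner ℝ v x ^ 2 - (‖x‖ ^ 2 + R ^ 2)) / τ ^ 2) +
          (ε * (2 / α) * K / τ +
            ε ^ 2 * (2 / α) * K ^ 2 * (2 * (2 / α - 2) * inner ℝ v x) / τ ^ 2)) := by
  have hw : HasFDerivAt (fun z => inner ℝ v z) (innerSL ℝ v) x := (innerSL ℝ v).hasFDerivAt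
  have h1 := (hw.const_mul (ε * (2 / α) * K / τ)).const_add 1
  have h2 := (((hw.mul hw).const_mul (2 / α - 1)).sub
    (hasFDerivAt_norm_sq_add R x)).const_mul (ε ^ 2 * (2 / α) * K ^ 2 / τ ^ 2)
  have h3 := ((hasFDerivAt_barrier (C := C) (α := α) hτ hR x).mul
    (h1.add h2)).const_mul (1 / (2 * (n : ℝ)))
  have h4 := h3.congr_of_eventuallyEq (f₁ := expansion C τ R α K ε v)
    (Filter.Eventually.of_forall fun z => by
      simp only [expansion, Pi.add_apply, Pi.mul_apply, Pi.sub_apply]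
      ring)
  rw [h4.fderiv]
  simp [hv, real_inner_comm v x]
  ring

lemma deriv_expansion {T c t : ℝ} (hτ : 0 < T - c * t) (hR : 0 < R) (K ε : ℝ)
    (v x : EuclideanSpace ℝ (Fin n)) :
    deriv (fun s => expansion C (T - c * s) R α K ε v x) t =
      1 / (2 * n) * barrier C (T - c * t) R α x * (-c / (T - c * t)) *
        (1 / α + (1 / α - 1) * (ε * (2 / α) * K * inner ℝ v x / (T - c * t)) +
          (1 / α - 2) * (ε ^ 2 * (2 / α) * K ^ 2 *
            ((2 / α - 1) * inner ℝ v x ^ 2 - (‖x‖ ^ 2 + R ^ 2)) / (T - c * t) ^ 2)) := by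
  have h0 : HasDerivAt (fun s => T - c * s) (-c) t := by
    simpa using ((hasDerivAt_id t).const_mul c).const_sub T
  have h1 := ((h0.fun_inv hτ.ne').const_mul (ε * (2 / α) * K * inner ℝ v x)).const_add 1
  have h2 := ((h0.fun_pow 2).fun_inv (by positivity)).const_mul (ε ^ 2 * (2 / α) * K ^ 2 *
    ((2 / α - 1) * inner ℝ v x ^ 2 - (‖x‖ ^ 2 + R ^ 2)))
  have h3 := ((hasDerivAt_barrier (C := C) (α := α) hτ hR x).mul
    (h1.add h2)).const_mul (1 / (2 * (n : ℝ)))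
  have h4 := h3.congr_of_eventuallyEq (f₁ := fun s => expansion C (T - c * s) R α K ε v x)
    (Filter.Eventually.of_forall fun z => by
      simp only [expansion, Pi.add_apply, Pi.mul_apply]
      ring)
  rw [h4.deriv]
  simp only [Pi.add_apply]
  field_simp
  ring

lemma expansion_eq_corrector (hτ : 0 < τ) {K ε r : ℝ} (hr : 0 < r)
    (v x : EuclideanSpace ℝ (Fin n)) (hr2 : ‖x‖ ^ 2 + R ^ 2 = r ^ 2) :
    expansion C τ R α K ε v x = barrier C τ R α x / (2 * n) *
      (1 + corrector (2 / α) K (ε * r / τ) (inner ℝ v x / r)) := by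
  unfold expansion corrector
  rw [hr2]
  have h1 : ε * (2 / α) * K * inner ℝ v x / τ =
      2 / α * K * (ε * r / τ) * (inner ℝ v x / r) := by field_simp
  have h2 : ε ^ 2 * (2 / α) * K ^ 2 * ((2 / α - 1) * inner ℝ v x ^ 2 - r ^ 2) / τ ^ 2 =
      2 / α * K ^ 2 * (ε * r / τ) ^ 2 * ((2 / α - 1) * (inner ℝ v x / r) ^ 2 - 1) := by
    generalize 2 / α = β
    field_simp
  rw [h1, h2]
  ring

lemma transport_expansion {T c t : ℝ} (hτ : 0 < T - c * t) (hR : 0 < R) {ε r : ℝ}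
    (hε : 0 < ε) (hr : 0 < r) (hn : (0 : ℝ) < n) (K : ℝ)
    {v : EuclideanSpace ℝ (Fin n)} (hv : ‖v‖ = 1) (x : EuclideanSpace ℝ (Fin n))
    (hr2 : ‖x‖ ^ 2 + R ^ 2 = r ^ 2) :
    deriv (fun s => expansion C (T - c * s) R α K ε v x) t +
        1 / ε * fderiv ℝ (expansion C (T - c * t) R α K ε v) x v =
      barrier C (T - c * t) R α x / (2 * n * (T - c * t)) *
        transport (2 / α) K c (ε * r / (T - c * t)) (inner ℝ v x / r) := by
  rw [deriv_expansion hτ hR, fderiv_expansion_apply hτ hR K ε hv, hr2]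
  unfold transport
  have h1 : 1 / α = 2 / α / 2 := by ring
  rw [h1]
  generalize 2 / α = β
  generalize T - c * t = τ at *
  generalize barrier C τ R α x = b
  generalize inner ℝ v x = w
  field_simp
  ring

lemma diffusivity_barrier (hC : 0 < C) (hτ : 0 < τ) (hR : 0 < R) (hα : 0 < α)
    (hn : (0 : ℝ) < n) (hnα : 0 < (n : ℝ) - 2 / α)
    (hCα : C ^ α = 2 * (n : ℝ) ^ (α - 1) * ((n : ℝ) - 2 / α))
    (x : EuclideanSpace ℝ (Fin n)) :
    ((n : ℝ) / barrier C τ R α x) ^ α =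
      (n : ℝ) / (2 * (n - 2 / α)) * (‖x‖ ^ 2 + R ^ 2) / τ := by
  have hq : 0 < ‖x‖ ^ 2 + R ^ 2 := by positivity
  rw [Real.div_rpow hn.le (barrier_pos hC hτ hR x).le, rpow_barrier hC hτ hR hα, hCα,
    Real.rpow_sub_one hn.ne']
  have h := Real.rpow_pos_of_pos hn α
  generalize 2 / α = β at *
  field_simp

lemma first_corrector_barrier {K : ℝ} (hτ : 0 < τ) (hR : 0 < R)
    (hD : ∀ z : EuclideanSpace ℝ (Fin n),
      ((n : ℝ) / barrier C τ R α z) ^ α = K * (‖z‖ ^ 2 + R ^ 2) / τ)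
    {i : Fin n} (x : EuclideanSpace ℝ (Fin n)) :
    ((n : ℝ) / barrier C τ R α x) ^ α * pd i (fun z => barrier C τ R α z) x =
      -(2 / α * K / τ) * (x i * barrier C τ R α x) := by
  have hq : 0 < ‖x‖ ^ 2 + R ^ 2 := by positivity
  rw [hD, pd_barrier hτ hR]
  generalize 2 / α = β
  field_simp

lemma second_corrector_barrier {K : ℝ} (hC : 0 < C) (hτ : 0 < τ) (hR : 0 < R) (hα : 0 < α)
    (hD : ∀ z : EuclideanSpace ℝ (Fin n),
      ((n : ℝ) / barrier C τ R α z) ^ α = K * (‖z‖ ^ 2 + R ^ 2) / τ)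
    {i : Fin n} (x : EuclideanSpace ℝ (Fin n)) :
    ((n : ℝ) / barrier C τ R α x) ^ α *
        pd i (fun y => ((n : ℝ) / barrier C τ R α y) ^ α *
          pd i (fun z => barrier C τ R α z) y) x -
      α / (2 * barrier C τ R α x) *
        (((n : ℝ) / barrier C τ R α x) ^ α * pd i (fun z => barrier C τ R α z) x) ^ 2 =
      2 / α * K ^ 2 * barrier C τ R α x *
        ((2 / α - 1) * x i ^ 2 - (‖x‖ ^ 2 + R ^ 2)) / τ ^ 2 := by
  have hq : 0 < ‖x‖ ^ 2 + R ^ 2 := by positivity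
  have hb := barrier_pos (α := α) hC hτ hR x
  simp_rw [first_corrector_barrier hτ hR hD]
  rw [pd_mul_coord_barrier hτ hR, hD]
  generalize barrier C τ R α x = b at *
  generalize ‖x‖ ^ 2 + R ^ 2 = q at *
  field_simp
  ring

end Calculus

/-- The second order asymptotic expansion
`u_i^ε = (1/(2n))(Ψ + εA_i + ε²B_i)` built from the barrier
`Ψ(x,t) = C_α ((T−ct)/(|x|²+R²))^{1/α}` is a positive classical subsolution of
the scaled Carleman system with interaction `k_α(a,b)=(a+b)^α` on the region
`ε(|x|²+R²)^{1/2} < c₃(T−ct)`, `0 ≤ t < T/c`, where `c₃ > 0` depends only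
on `c, n, α`. -/
theorem expansion_is_local_subsolution (n : ℕ) (hn : 3 ≤ n) (α c : ℝ)
    (hα : 2 / (n : ℝ) < α ∧ α ≤ 1)
    (hc : c - 1 > (2 / α) * (1 / ((n : ℝ) - 2 / α))) :
    ∃ c₃ > (0 : ℝ), ∀ (R T Cα : ℝ), 0 < R → 0 < T → 0 < Cα →
      Cα ^ α = 2 * (n : ℝ) ^ (α - 1) * ((n : ℝ) - 2 / α) →
      ∀ Ψ : EuclideanSpace ℝ (Fin n) → ℝ → ℝ,
      (∀ x s, Ψ x s = Cα * ((T - c * s) / (‖x‖ ^ 2 + R ^ 2)) ^ (1 / α)) →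
      ∀ A B : (Fin n ⊕ Fin n) → EuclideanSpace ℝ (Fin n) → ℝ → ℝ,
      (∀ (i : Fin n) x s,
        A (Sum.inl i) x s = -(((n : ℝ) / Ψ x s) ^ α) * pd i (fun z => Ψ z s) x) →
      (∀ (i : Fin n) x s, A (Sum.inr i) x s = -A (Sum.inl i) x s) →
      (∀ (i : Fin n) x s,
        B (Sum.inl i) x s = ((n : ℝ) / Ψ x s) ^ α *
            pd i (fun y => ((n : ℝ) / Ψ y s) ^ α * pd i (fun z => Ψ z s) y) x -
          (α / (2 * Ψ x s)) *
            (((n : ℝ) / Ψ x s) ^ α * pd i (fun z => Ψ z s) x) ^ 2) →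
      (∀ (i : Fin n) x s, B (Sum.inr i) x s = B (Sum.inl i) x s) →
      ∀ ε : ℝ, 0 < ε →
      ∀ u : (Fin n ⊕ Fin n) → EuclideanSpace ℝ (Fin n) → ℝ → ℝ,
      (∀ i x s, u i x s = (1 / (2 * (n : ℝ))) *
        (Ψ x s + ε * A i x s + ε ^ 2 * B i x s)) →
      ∀ (x : EuclideanSpace ℝ (Fin n)) (t : ℝ), 0 ≤ t → t < T / c →
        ε * (‖x‖ ^ 2 + R ^ 2) ^ ((1 : ℝ) / 2) < c₃ * (T - c * t) →
        ∀ i, 0 < u i x t ∧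
          deriv (fun s => u i x s) t +
            (1 / ε) * fderiv ℝ (fun y => u i y t) x (vel i) -
            (1 / (2 * (n : ℝ) * ε ^ 2)) *
              ∑ j, (u i x t + u j x t) ^ α * (u j x t - u i x t) ≤ 0 := by
  have hn0 : (0 : ℝ) < n := by exact_mod_cast (show 0 < n by omega)
  obtain ⟨hα2, hα1⟩ := hα
  have hα0 : 0 < α := lt_trans (by positivity) hα2
  have hβn : 2 / α < n := by
    rw [div_lt_iff₀ hn0] at hα2
    rw [div_lt_iff₀ hα0]
    linarith
  have hβ : 2 ≤ 2 / α := by rw [le_div_iff₀ hα0]; linarith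
  have hnβ : 0 < (n : ℝ) - 2 / α := by linarith
  obtain ⟨K, hKdef⟩ : ∃ K, K = (n : ℝ) / (2 * (n - 2 / α)) := ⟨_, rfl⟩
  have hK : 0 < K := by rw [hKdef]; positivity
  have hKc : K < c / 2 := by
    have h1 : 2 * K = 1 + 2 / α * (1 / (n - 2 / α)) := by
      rw [hKdef]
      generalize 2 / α = β at *
      field_simp
      ring
    linarith
  have hc0 : 0 < c := by linarith
  have hM : 0 < errorConst (2 / α) K c := by unfold errorConst; positivity
  have hδ : 0 < 2 / α * (c / 2 - K) := mul_pos (by positivity) (by linarith)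
  have hL : 0 < 2 / α * K + (2 / α) ^ 2 * K ^ 2 := by positivity
  refine ⟨min 1 (min (1 / 2 / (2 / α * K + (2 / α) ^ 2 * K ^ 2))
    (2 / α * (c / 2 - K) / errorConst (2 / α) K c)), by positivity, ?_⟩
  intro R T C hR hT hC hCα Ψ hΨ A B hA hA' hB hB' ε hε u hu x t ht htT hx i
  obtain rfl : Ψ = fun x s => barrier C (T - c * s) R α x := by
    funext x s
    exact hΨ x s
  have hτ : 0 < T - c * t := by
    rw [lt_div_iff₀ hc0] at htT
    linarith
  have hue : ∀ j z s, 0 < T - c * s →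
      u j z s = expansion C (T - c * s) R α K ε (vel j) z := by
    intro j z s hs
    have hD : ∀ z : EuclideanSpace ℝ (Fin n), ((n : ℝ) / barrier C (T - c * s) R α z) ^ α =
        K * (‖z‖ ^ 2 + R ^ 2) / (T - c * s) := by
      intro z
      rw [hKdef]
      exact diffusivity_barrier hC hs hR hα0 hn0 hnβ hCα z
    rcases j with j | j
    · rw [hu, hA, hB]
      dsimp only
      rw [neg_mul, second_corrector_barrier hC hs hR hα0 hD, first_corrector_barrier hs hR hD]
      simp only [expansion, inner_vel_inl]
      ring
    · rw [hu, hA', hB', hA, hB]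
      dsimp only
      rw [neg_mul, second_corrector_barrier hC hs hR hα0 hD, first_corrector_barrier hs hR hD]
      simp only [expansion, inner_vel_inr]
      ring
  set τ := T - c * t with hτdef
  have hq : 0 < ‖x‖ ^ 2 + R ^ 2 := by positivity
  rw [← Real.sqrt_eq_rpow] at hx
  obtain ⟨r, hr⟩ : ∃ r, r = √(‖x‖ ^ 2 + R ^ 2) := ⟨_, rfl⟩
  have hr0 : 0 < r := by rw [hr]; positivity
  have hr2 : ‖x‖ ^ 2 + R ^ 2 = r ^ 2 := by rw [hr, Real.sq_sqrt hq.le]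
  rw [← hr, ← div_lt_iff₀ hτ, lt_min_iff, lt_min_iff, lt_div_iff₀ hL, lt_div_iff₀ hM] at hx
  obtain ⟨hη1, hηL, hηM⟩ := hx
  have hη : 0 < ε * r / τ := by positivity
  have hxr : ‖x‖ ≤ r := abs_le_of_sq_le_sq' (by nlinarith) hr0.le |>.2
  have hp : ∀ j : Fin n ⊕ Fin n, |inner ℝ (vel j) x / r| ≤ 1 := by
    intro j
    rw [abs_div, abs_of_pos hr0, div_le_one hr0]
    refine (abs_real_inner_le_norm _ _).trans ?_
    rw [norm_vel, one_mul]
    exact hxr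
  have hut : ∀ j, u j x t = barrier C τ R α x / (2 * n) *
      (1 + corrector (2 / α) K (ε * r / τ) (inner ℝ (vel j) x / r)) := by
    intro j
    rw [hue j x t hτ, expansion_eq_corrector hτ hr0 _ _ hr2]
  have ha : ∀ j : Fin n ⊕ Fin n,
      |corrector (2 / α) K (ε * r / τ) (inner ℝ (vel j) x / r)| ≤ 1 / 2 := fun j =>
    (abs_corrector_le hβ hK hη hη1.le (hp j)).trans (by linarith)
  have hb := barrier_pos (α := α) hC hτ hR x
  refine ⟨?_, ?_⟩
  · rw [hut]
    have := (abs_le.1 (ha i)).1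
    exact mul_pos (by positivity) (by linarith)
  have hderiv : deriv (fun s => u i x s) t =
      deriv (fun s => expansion C (T - c * s) R α K ε (vel i) x) t := by
    refine Filter.EventuallyEq.deriv_eq ?_
    have hcont : ContinuousAt (fun s => T - c * s) t := by fun_prop
    filter_upwards [hcont.eventually (lt_mem_nhds hτ)] with s hs
    exact hue i x s hs
  have hfderiv : (fun y => u i y t) = expansion C τ R α K ε (vel i) :=
    funext fun y => hue i y t hτ
  have hcoll : ∀ j, (u i x t + u j x t) ^ α * (u j x t - u i x t) =
      τ / (K * r ^ 2) * (barrier C τ R α x / (2 * n)) *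
      ((1 + (corrector (2 / α) K (ε * r / τ) (inner ℝ (vel i) x / r) +
        corrector (2 / α) K (ε * r / τ) (inner ℝ (vel j) x / r)) / 2) ^ α *
      (corrector (2 / α) K (ε * r / τ) (inner ℝ (vel j) x / r) -
        corrector (2 / α) K (ε * r / τ) (inner ℝ (vel i) x / r))) := by
    intro j
    have hD := diffusivity_barrier hC hτ hR hα0 hn0 hnβ hCα x
    rw [← hKdef, hr2] at hD
    have hD' : (barrier C τ R α x / n) ^ α = τ / (K * r ^ 2) := by
      rw [← inv_div, Real.inv_rpow (by positivity), hD, inv_div]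
    rw [hut, hut, ← hD']
    have hi := (abs_le.1 (ha i)).1
    have hj := (abs_le.1 (ha j)).1
    generalize corrector (2 / α) K (ε * r / τ) (inner ℝ (vel i) x / r) = a at *
    generalize corrector (2 / α) K (ε * r / τ) (inner ℝ (vel j) x / r) = b at *
    have hsum : barrier C τ R α x / (2 * n) * (1 + a) + barrier C τ R α x / (2 * n) * (1 + b) =
        barrier C τ R α x / n * (1 + (a + b) / 2) := by
      field_simp
      ring
    rw [hsum, Real.mul_rpow (by positivity) (by linarith)]
    ring
  have key := transport_sub_collision_nonpos (show 0 < n by omega)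
    (mul_div_cancel₀ 2 hα0.ne') hα0 hα1 hβ hK hc0 hη hη1.le (by linarith) (by linarith)
    (fun j => inner ℝ (vel (Sum.inl j)) x / r) (fun j => hp (Sum.inl j)) _ (hp i)
  have hinr : ∀ j : Fin n, inner ℝ (vel (Sum.inr j)) x / r =
      -(inner ℝ (vel (Sum.inl j)) x / r) := by
    intro j
    rw [inner_vel_inl, inner_vel_inr, neg_div]
  simp_rw [hcoll]
  rw [← Finset.mul_sum, Fintype.sum_sum_type]
  simp_rw [hinr]
  rw [hderiv, hfderiv, transport_expansion hτ hR hε hr0 hn0 K (norm_vel i) x hr2,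
    ← hτdef]
  have hscale : 0 ≤ barrier C τ R α x / (2 * n * τ) := by positivity
  refine le_trans (le_of_eq ?_) (mul_nonpos_of_nonneg_of_nonpos hscale key)
  generalize Finset.sum (ι := Fin n) (M := ℝ) _ _ + Finset.sum (ι := Fin n) (M := ℝ) _ _ = S
  generalize transport _ _ _ _ _ = E
  field_simp
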